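/- There exists n₀ such that for all n ≥ n₀ the following holds with N := ⌊2^{10^{-10}·n}⌋ and ℓ := ⌊10^{-8}·n⌋: the fraction of tuples C = (c¹, …, c^N) ∈ ({0,1,2,3}^n)^N such that for every ℓ-adaptive orthonormal basis (φ_x)_{x ∈ {0,1}^n} of ℂ^({0,1}^n) one has Σ_{x ∈ {0,1}^n} | Σ_{s ≠ t} ⟨φ_x, ψ_{c^s}⟩·conj(⟨φ_x, ψ_{c^t}⟩) | ≤ 5, is at least 0.9. -/

import Mathlib

open ComplexConjugate
open scoped Classical

/-- The four SIC-POVM qubit states. -/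
noncomputable def chi : Fin 4 → Fin 2 → ℂ
  | 0 => ![1, 0]
  | 1 => ![(Real.sqrt 3 : ℂ)⁻¹, (Real.sqrt (2 / 3) : ℂ)]
  | 2 => ![(Real.sqrt 3 : ℂ)⁻¹,
      (Real.sqrt (2 / 3) : ℂ) * Complex.exp (2 * (Real.pi : ℂ) * Complex.I / 3)]
  | 3 => ![(Real.sqrt 3 : ℂ)⁻¹,
      (Real.sqrt (2 / 3) : ℂ) * Complex.exp (4 * (Real.pi : ℂ) * Complex.I / 3)]

/-- The SIC product state ψ_c for c ∈ {0,1,2,3}^n. -/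
noncomputable def sicProd (n : ℕ) (c : Fin n → Fin 4) : (Fin n → Fin 2) → ℂ :=
  fun x => ∏ i, chi (c i) (x i)

/-- An ℓ-adaptive orthonormal basis of ℂ^({0,1}^n): an orthonormal basis (φ_x) such that
for some S ⊆ [n] with |S| ≤ ℓ, the qubits outside S are measured in fixed single-qubit
bases and the qubits in S in an arbitrary basis depending on the outcomes outside S. -/
def IsAdaptiveBasis (n ℓ : ℕ) (φ : (Fin n → Fin 2) → (Fin n → Fin 2) → ℂ) : Prop :=
  (∀ x x', ∑ y, conj (φ x y) * φ x' y = if x = x' then 1 else 0) ∧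
  ∃ S : Finset (Fin n), S.card ≤ ℓ ∧
    ∃ (q : Fin n → Fin 2 → Fin 2 → ℂ)
      (g : ({i : Fin n // i ∉ S} → Fin 2) → ({i : Fin n // i ∈ S} → Fin 2) →
        ({i : Fin n // i ∈ S} → Fin 2) → ℂ),
      (∀ i, i ∉ S → ∀ a b, ∑ j, conj (q i a j) * q i b j = if a = b then 1 else 0) ∧
      (∀ w z z', ∑ u, conj (g w z u) * g w z' u = if z = z' then 1 else 0) ∧
      (∀ x y, φ x y =
        (∏ i : {i : Fin n // i ∉ S}, q i.val (x i.val) (y i.val)) *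
          g (fun i => x i.val) (fun i => x i.val) (fun i => y i.val))

/-- N = ⌊2^{10⁻¹⁰·n}⌋. -/
noncomputable def NN (n : ℕ) : ℕ := Nat.floor ((2 : ℝ) ^ ((10 : ℝ) ^ (-10 : ℝ) * n))

/-- The overlap `⟨f, u⟩`, conjugate-linear in the first argument. -/
noncomputable def overlap {ι : Type*} [Fintype ι] (f u : ι → ℂ) : ℂ := ∑ y, conj (f y) * u y

/-- The product of SIC states over an arbitrary finite index type. -/
noncomputable def prodState {ι : Type*} [Fintype ι] (c : ι → Fin 4) : (ι → Fin 2) → ℂ :=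
  fun x => ∏ i, chi (c i) (x i)

/-- A finite family indexed by the coordinates is orthonormal. -/
def IsONB {ι : Type*} [Fintype ι] [DecidableEq ι] (φ : ι → ι → ℂ) : Prop :=
  ∀ x x', ∑ y, conj (φ x y) * φ x' y = if x = x' then 1 else 0

/-- The Bhattacharyya coefficient of the outcome distributions of two SIC states. -/
noncomputable def fidelity (q : Fin 2 → Fin 2 → ℂ) (a b : Fin 4) : ℝ :=
  ∑ j, ‖overlap (q j) (chi a)‖ * ‖overlap (q j) (chi b)‖

theorem overlap_self {ι : Type*} [Fintype ι] (u : ι → ℂ) :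
    overlap u u = ((∑ y, ‖u y‖ ^ 2 : ℝ) : ℂ) := by
  simp [overlap, Complex.conj_mul']

theorem IsONB.parseval {ι : Type*} [Fintype ι] [DecidableEq ι] {φ : ι → ι → ℂ}
    (h : IsONB φ) (u v : ι → ℂ) :
    ∑ x, conj (overlap (φ x) u) * overlap (φ x) v = overlap u v := by
  have h1 : (Matrix.of fun x y => conj (φ x y)) * (Matrix.of fun x y => φ y x) = 1 := by
    ext x x'
    simp [Matrix.mul_apply, h x x', Matrix.one_apply]
  have h2 := mul_eq_one_comm.1 h1
  have h3 : ∀ y y', ∑ x, φ x y * conj (φ x y') = if y = y' then 1 else 0 := by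
    intro y y'
    have := congrFun (congrFun h2 y) y'
    simpa [Matrix.mul_apply, Matrix.one_apply] using this
  calc ∑ x, conj (overlap (φ x) u) * overlap (φ x) v
      = ∑ x, ∑ y, ∑ y', (conj (u y) * v y') * (φ x y * conj (φ x y')) := by
        refine Finset.sum_congr rfl fun x _ => ?_
        simp only [overlap, map_sum, map_mul, Complex.conj_conj, Finset.sum_mul_sum]
        refine Finset.sum_congr rfl fun y _ => Finset.sum_congr rfl fun y' _ => ?_
        ring
    _ = ∑ y, ∑ y', (conj (u y) * v y') * ∑ x, φ x y * conj (φ x y') := by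
        rw [Finset.sum_comm]
        refine Finset.sum_congr rfl fun y _ => ?_
        rw [Finset.sum_comm]
        simp only [Finset.mul_sum]
    _ = overlap u v := by simp [h3, overlap]

theorem IsONB.sum_norm_sq {ι : Type*} [Fintype ι] [DecidableEq ι] {φ : ι → ι → ℂ}
    (h : IsONB φ) (u : ι → ℂ) :
    ∑ x, ‖overlap (φ x) u‖ ^ 2 = ∑ y, ‖u y‖ ^ 2 := by
  have := h.parseval u u
  rw [overlap_self] at this
  simp only [Complex.conj_mul'] at this
  exact_mod_cast this

theorem IsONB.sum_norm_mul_norm_le {ι : Type*} [Fintype ι] [DecidableEq ι] {φ : ι → ι → ℂ}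
    (h : IsONB φ) {u v : ι → ℂ} (hu : ∑ y, ‖u y‖ ^ 2 = 1) (hv : ∑ y, ‖v y‖ ^ 2 = 1) :
    ∑ x, ‖overlap (φ x) u‖ * ‖overlap (φ x) v‖ ≤ 1 := by
  have h1 := h.sum_norm_sq u
  have h2 := h.sum_norm_sq v
  have := Finset.sum_mul_sq_le_sq_mul_sq Finset.univ
    (fun x => ‖overlap (φ x) u‖) (fun x => ‖overlap (φ x) v‖)
  rw [h1, h2, hu, hv] at this
  exact (sq_le_one_iff₀ (by positivity)).1 (by linarith)

theorem overlap_prod {ι : Type*} [Fintype ι] [DecidableEq ι] (f u : ι → Fin 2 → ℂ) :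
    overlap (fun y : ι → Fin 2 => ∏ i, f i (y i)) (fun y => ∏ i, u i (y i))
      = ∏ i, overlap (f i) (u i) := by
  simp only [overlap, map_prod, ← Finset.prod_mul_distrib]
  rw [Fintype.prod_sum]

theorem exp_two_pi_div_three :
    Complex.exp (2 * (Real.pi : ℂ) * Complex.I / 3) = ⟨-1 / 2, Real.sqrt 3 / 2⟩ := by
  have : (2 * (Real.pi : ℂ) * Complex.I / 3) = ((Real.pi - Real.pi / 3 : ℝ) : ℂ) * Complex.I := by
    push_cast; ring
  rw [this]
  apply Complex.ext
  · rw [Complex.exp_ofReal_mul_I_re, Real.cos_pi_sub, Real.cos_pi_div_three]; norm_num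
  · rw [Complex.exp_ofReal_mul_I_im, Real.sin_pi_sub, Real.sin_pi_div_three]

theorem exp_four_pi_div_three :
    Complex.exp (4 * (Real.pi : ℂ) * Complex.I / 3) = ⟨-1 / 2, -(Real.sqrt 3 / 2)⟩ := by
  have : (4 * (Real.pi : ℂ) * Complex.I / 3) = ((Real.pi / 3 + Real.pi : ℝ) : ℂ) * Complex.I := by
    push_cast; ring
  rw [this]
  apply Complex.ext
  · rw [Complex.exp_ofReal_mul_I_re, Real.cos_add_pi, Real.cos_pi_div_three]; norm_num
  · rw [Complex.exp_ofReal_mul_I_im, Real.sin_add_pi, Real.sin_pi_div_three]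

theorem sqrt_two_thirds_eq : Real.sqrt (2 / 3) = Real.sqrt 2 * Real.sqrt 3 / 3 := by
  rw [Real.sqrt_div (by norm_num)]
  have h3 : Real.sqrt 3 ^ 2 = 3 := Real.sq_sqrt (by norm_num)
  have : Real.sqrt 3 ≠ 0 := by positivity
  field_simp
  linarith

theorem sqrt_three_inv_eq : (Real.sqrt 3)⁻¹ = Real.sqrt 3 / 3 := by
  have h3 : Real.sqrt 3 ^ 2 = 3 := Real.sq_sqrt (by norm_num)
  have : Real.sqrt 3 ≠ 0 := by positivity
  field_simp
  linarith

theorem norm_overlap_chi_sq (f : Fin 2 → ℂ) (a : Fin 4) :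
    ‖overlap f (chi a)‖ ^ 2 =
      match a with
      | 0 => ‖f 0‖ ^ 2
      | 1 => ‖f 0‖ ^ 2 / 3 + 2 * ‖f 1‖ ^ 2 / 3 +
          2 * Real.sqrt 2 / 3 * ((f 0).re * (f 1).re + (f 0).im * (f 1).im)
      | 2 => ‖f 0‖ ^ 2 / 3 + 2 * ‖f 1‖ ^ 2 / 3 -
          Real.sqrt 2 / 3 * (((f 0).re * (f 1).re + (f 0).im * (f 1).im) -
            Real.sqrt 3 * ((f 0).re * (f 1).im - (f 0).im * (f 1).re))
      | 3 => ‖f 0‖ ^ 2 / 3 + 2 * ‖f 1‖ ^ 2 / 3 -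
          Real.sqrt 2 / 3 * (((f 0).re * (f 1).re + (f 0).im * (f 1).im) +
            Real.sqrt 3 * ((f 0).re * (f 1).im - (f 0).im * (f 1).re)) := by
  have h2 : Real.sqrt 2 ^ 2 = 2 := Real.sq_sqrt (by norm_num)
  have h3 : Real.sqrt 3 ^ 2 = 3 := Real.sq_sqrt (by norm_num)
  have e1 : ((Real.sqrt 3 : ℂ)⁻¹) = ⟨Real.sqrt 3 / 3, 0⟩ := by
    rw [← sqrt_three_inv_eq, ← Complex.ofReal_inv]; rfl
  have e2 : (Real.sqrt (2 / 3) : ℂ) = ⟨Real.sqrt 2 * Real.sqrt 3 / 3, 0⟩ := by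
    rw [sqrt_two_thirds_eq]; rfl
  generalize hu1 : (f 0).re = u1
  generalize hu2 : (f 0).im = u2
  generalize hv1 : (f 1).re = v1
  generalize hv2 : (f 1).im = v2
  fin_cases a
  · simp [overlap, chi]
  · simp only [overlap, Fin.sum_univ_two, chi, e1, e2]
    simp [Complex.sq_norm, Complex.normSq_apply, hu1, hu2, hv1, hv2]
    generalize Real.sqrt 3 = A at *
    generalize Real.sqrt 2 = B at *
    linear_combination ((u1 + B * v1) ^ 2 + (u2 + B * v2) ^ 2) / 9 * h3
      + (v1 ^ 2 + v2 ^ 2) / 3 * h2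
  · simp only [overlap, Fin.sum_univ_two, chi, exp_two_pi_div_three, e1, e2]
    simp [Complex.sq_norm, Complex.normSq_apply, hu1, hu2, hv1, hv2]
    generalize Real.sqrt 3 = A at *
    generalize Real.sqrt 2 = B at *
    linear_combination ((u1 + B * (-v1 / 2 + A * v2 / 2)) ^ 2 +
        (-u2 + B * (A * v1 / 2 + v2 / 2)) ^ 2) / 9 * h3
      + (1 + A ^ 2) * (v1 ^ 2 + v2 ^ 2) / 12 * h2 + (v1 ^ 2 + v2 ^ 2) / 6 * h3
  · simp only [overlap, Fin.sum_univ_two, chi, exp_four_pi_div_three, e1, e2]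
    simp [Complex.sq_norm, Complex.normSq_apply, hu1, hu2, hv1, hv2]
    generalize Real.sqrt 3 = A at *
    generalize Real.sqrt 2 = B at *
    linear_combination ((u1 + B * (-v1 / 2 - A * v2 / 2)) ^ 2 +
        (-u2 + B * (-A * v1 / 2 + v2 / 2)) ^ 2) / 9 * h3
      + (1 + A ^ 2) * (v1 ^ 2 + v2 ^ 2) / 12 * h2 + (v1 ^ 2 + v2 ^ 2) / 6 * h3

theorem sum_norm_overlap_chi_sq {f : Fin 2 → ℂ} (hf : ∑ j, ‖f j‖ ^ 2 = 1) :
    ∑ a, ‖overlap f (chi a)‖ ^ 2 = 2 := by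
  rw [Fin.sum_univ_two] at hf
  simp only [Fin.sum_univ_four, norm_overlap_chi_sq]
  linear_combination 2 * hf

theorem sum_norm_overlap_chi_sq_sq {f : Fin 2 → ℂ} (hf : ∑ j, ‖f j‖ ^ 2 = 1) :
    ∑ a, (‖overlap f (chi a)‖ ^ 2) ^ 2 = 4 / 3 := by
  have h2 : Real.sqrt 2 ^ 2 = 2 := Real.sq_sqrt (by norm_num)
  have h3 : Real.sqrt 3 ^ 2 = 3 := Real.sq_sqrt (by norm_num)
  rw [Fin.sum_univ_two] at hf
  simp only [Fin.sum_univ_four, norm_overlap_chi_sq]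
  have hXY : ((f 0).re * (f 1).re + (f 0).im * (f 1).im) ^ 2
      + ((f 0).re * (f 1).im - (f 0).im * (f 1).re) ^ 2 = ‖f 0‖ ^ 2 * ‖f 1‖ ^ 2 := by
    simp only [Complex.sq_norm, Complex.normSq_apply]; ring
  generalize (f 0).re * (f 1).re + (f 0).im * (f 1).im = X at *
  generalize (f 0).re * (f 1).im - (f 0).im * (f 1).re = Y at *
  generalize Real.sqrt 3 = A at *
  generalize Real.sqrt 2 = B at *
  generalize ‖f 0‖ ^ 2 = P at *
  generalize ‖f 1‖ ^ 2 = Q at *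
  obtain rfl : Q = 1 - P := by linarith
  linear_combination (2 * X ^ 2 / 3 + 2 * Y ^ 2 / 3) * h2 + 2 * B ^ 2 * Y ^ 2 / 9 * h3
    + 4 / 3 * hXY

theorem sum_norm_chi_sq (a : Fin 4) : ∑ j, ‖chi a j‖ ^ 2 = 1 := by
  have h := norm_overlap_chi_sq ![1, 0] a
  have h' := norm_overlap_chi_sq ![0, 1] a
  have e1 : overlap ![1, 0] (chi a) = chi a 0 := by simp [overlap]
  have e2 : overlap ![0, 1] (chi a) = chi a 1 := by simp [overlap]
  rw [e1] at h
  rw [e2] at h'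
  rw [Fin.sum_univ_two, h, h']
  fin_cases a <;> norm_num

theorem norm_overlap_chi_zero_three_sq : ‖overlap (chi 0) (chi 3)‖ ^ 2 = 1 / 3 := by
  rw [norm_overlap_chi_sq]
  simp [chi]

theorem norm_overlap_le_one {ι : Type*} [Fintype ι] {u v : ι → ℂ}
    (hu : ∑ y, ‖u y‖ ^ 2 = 1) (hv : ∑ y, ‖v y‖ ^ 2 = 1) : ‖overlap u v‖ ≤ 1 := by
  have h := Finset.sum_mul_sq_le_sq_mul_sq Finset.univ (fun y => ‖u y‖) (fun y => ‖v y‖)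
  rw [hu, hv] at h
  calc ‖overlap u v‖ ≤ ∑ y, ‖conj (u y) * v y‖ := norm_sum_le _ _
    _ = ∑ y, ‖u y‖ * ‖v y‖ := by simp
    _ ≤ 1 := (sq_le_one_iff₀ (by positivity)).1 (by linarith)

theorem overlap_prodState {ι : Type*} [Fintype ι] [DecidableEq ι] (c d : ι → Fin 4) :
    overlap (prodState c) (prodState d) = ∏ i, overlap (chi (c i)) (chi (d i)) :=
  overlap_prod _ _

theorem sum_norm_prodState_sq {ι : Type*} [Fintype ι] [DecidableEq ι] (c : ι → Fin 4) :
    ∑ y, ‖prodState c y‖ ^ 2 = 1 := by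
  have h := overlap_prodState c c
  simp only [overlap_self, sum_norm_chi_sq, Complex.ofReal_one, Finset.prod_const_one] at h
  exact_mod_cast h

theorem fidelity_nonneg (q : Fin 2 → Fin 2 → ℂ) (a b : Fin 4) : 0 ≤ fidelity q a b := by
  unfold fidelity; positivity

theorem fidelity_le_one {q : Fin 2 → Fin 2 → ℂ} (hq : IsONB q) (a b : Fin 4) :
    fidelity q a b ≤ 1 :=
  hq.sum_norm_mul_norm_le (sum_norm_chi_sq a) (sum_norm_chi_sq b)

theorem fidelity_le {q : Fin 2 → Fin 2 → ℂ} (hq : IsONB q) (a b : Fin 4) :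
    fidelity q a b ≤
      1 - (‖overlap (q 0) (chi a)‖ ^ 2 - ‖overlap (q 0) (chi b)‖ ^ 2) ^ 2 / 8 := by
  have ha := hq.sum_norm_sq (chi a)
  have hb := hq.sum_norm_sq (chi b)
  rw [sum_norm_chi_sq, Fin.sum_univ_two] at ha hb
  rw [fidelity, Fin.sum_univ_two]
  have h1 := norm_nonneg (overlap (q 0) (chi a))
  have h2 := norm_nonneg (overlap (q 0) (chi b))
  generalize ‖overlap (q 0) (chi a)‖ = r at *
  generalize ‖overlap (q 0) (chi b)‖ = s at *
  generalize ‖overlap (q 1) (chi a)‖ = r' at *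
  generalize ‖overlap (q 1) (chi b)‖ = s' at *
  have h3 : (r + s) ^ 2 ≤ 4 := by nlinarith [sq_nonneg (r - s), sq_nonneg r', sq_nonneg s']
  have h4 : (r - s) ^ 2 * (r + s) ^ 2 ≤ (r - s) ^ 2 * 4 :=
    mul_le_mul_of_nonneg_left h3 (sq_nonneg _)
  nlinarith [sq_nonneg (r' - s')]

/-- Along a spanning tree of the four SIC states, no single-qubit basis can keep all three
fidelities close to one. -/
theorem fidelity_tree_le {q : Fin 2 → Fin 2 → ℂ} (hq : IsONB q) {b c : Fin 4}
    (hb : b = 0 ∨ b = 1) (hc : c = 0 ∨ c = 1 ∨ c = 2) :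
    fidelity q 0 1 * fidelity q b 2 * fidelity q c 3 ≤ Real.exp (-(1 / 216)) := by
  have hf : ∑ j, ‖q 0 j‖ ^ 2 = 1 := by
    have h := hq 0 0
    simp only [Complex.conj_mul', if_true] at h
    exact_mod_cast h
  have hs := sum_norm_overlap_chi_sq hf
  have hss := sum_norm_overlap_chi_sq_sq hf
  have h1 := fidelity_le hq 0 1
  have h2 := fidelity_le hq b 2
  have h3 := fidelity_le hq c 3
  rw [Fin.sum_univ_four] at hs hss
  have key : (1 : ℝ) / 27 ≤ (‖overlap (q 0) (chi 0)‖ ^ 2 - ‖overlap (q 0) (chi 1)‖ ^ 2) ^ 2 +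
      (‖overlap (q 0) (chi b)‖ ^ 2 - ‖overlap (q 0) (chi 2)‖ ^ 2) ^ 2 +
      (‖overlap (q 0) (chi c)‖ ^ 2 - ‖overlap (q 0) (chi 3)‖ ^ 2) ^ 2 := by
    generalize hp : (fun a => ‖overlap (q 0) (chi a)‖ ^ 2) = p
    have hp' : ∀ a, ‖overlap (q 0) (chi a)‖ ^ 2 = p a := fun a => congrFun hp a
    simp only [hp'] at hs hss ⊢
    have hD : 1 / 3 ≤ (p 1 - p 0) ^ 2 + (p 2 - p 0) ^ 2 + (p 3 - p 0) ^ 2 := by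
      nlinarith [sq_nonneg (p 0 - 1 / 2)]
    have three : ∀ x y z : ℝ, (x + y + z) ^ 2 ≤ 3 * (x ^ 2 + y ^ 2 + z ^ 2) := fun x y z => by
      nlinarith [sq_nonneg (x - y), sq_nonneg (y - z), sq_nonneg (x - z)]
    have n1 := sq_nonneg (p 0 - p 1)
    have n2 := sq_nonneg (p b - p 2)
    have n3 := sq_nonneg (p c - p 3)
    have b1 : (p b - p 0) ^ 2 ≤ (p 0 - p 1) ^ 2 := by
      rcases hb with rfl | rfl <;> linarith
    have b2 : (p 2 - p 0) ^ 2 ≤ 2 * ((p 0 - p 1) ^ 2 + (p b - p 2) ^ 2) := by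
      linarith [sq_nonneg ((p b - p 0) + (p b - p 2))]
    have b3 : (p 3 - p 0) ^ 2 ≤
        3 * ((p 0 - p 1) ^ 2 + (p b - p 2) ^ 2 + (p c - p 3) ^ 2) := by
      rcases hc with rfl | rfl | rfl
      · linarith
      · linarith [three (p 1 - p 0) 0 (p 3 - p 1)]
      · linarith [three (p b - p 0) (p 2 - p b) (p 3 - p 2)]
    linarith
  have hexp : ∀ y : ℝ, 1 - y ≤ Real.exp (-y) := fun y => by linarith [Real.add_one_le_exp (-y)]
  calc _ ≤ Real.exp (-((‖overlap (q 0) (chi 0)‖ ^ 2 - ‖overlap (q 0) (chi 1)‖ ^ 2) ^ 2 / 8)) *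
        Real.exp (-((‖overlap (q 0) (chi b)‖ ^ 2 - ‖overlap (q 0) (chi 2)‖ ^ 2) ^ 2 / 8)) *
        Real.exp (-((‖overlap (q 0) (chi c)‖ ^ 2 - ‖overlap (q 0) (chi 3)‖ ^ 2) ^ 2 / 8)) := by
        have := fidelity_nonneg q 0 1
        have := fidelity_nonneg q b 2
        have := fidelity_nonneg q c 3
        gcongr <;> exact le_trans (by assumption) (hexp _)
    _ ≤ _ := by
        rw [← Real.exp_add, ← Real.exp_add]
        exact Real.exp_le_exp.2 (by linarith)

theorem overlap_adaptive {n : ℕ} {S : Finset (Fin n)} {q : Fin n → Fin 2 → Fin 2 → ℂ}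
    {g : ({i : Fin n // i ∈ S} → Fin 2) → ℂ} {f : (Fin n → Fin 2) → ℂ} (x : Fin n → Fin 2)
    (hf : ∀ y, f y = (∏ i : {i : Fin n // i ∉ S}, q i.val (x i.val) (y i.val)) *
      g (fun i => y i.val)) (c : Fin n → Fin 4) :
    overlap f (prodState c) =
      (∏ i : {i : Fin n // i ∉ S}, overlap (q i.val (x i.val)) (chi (c i.val))) *
        overlap g (prodState fun i : {i : Fin n // i ∈ S} => c i.val) := by
  rw [← overlap_prod]
  simp only [overlap, hf, prodState]
  rw [← Equiv.sum_comp (Equiv.piEquivPiSubtypeProd (fun i => i ∈ S) (fun _ => Fin 2)).symm,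
    Fintype.sum_prod_type, Finset.sum_comm, Finset.sum_mul_sum]
  refine Finset.sum_congr rfl fun v _ => Finset.sum_congr rfl fun u _ => ?_
  have hsplit : ∀ F : Fin n → ℂ,
      ∏ i, F i = (∏ i : {i : Fin n // i ∈ S}, F i) * ∏ i : {i : Fin n // i ∉ S}, F i := fun F => by
    convert (Fintype.prod_subtype_mul_prod_subtype (fun i => i ∈ S) F).symm
  rw [hsplit]
  have h1 : ∀ i : {i : Fin n // i ∈ S},
      (Equiv.piEquivPiSubtypeProd (fun i => i ∈ S) (fun _ => Fin 2)).symm (u, v) i.val = u i := by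
    intro i; simp [i.2]
  have h2 : ∀ i : {i : Fin n // i ∉ S},
      (Equiv.piEquivPiSubtypeProd (fun i => i ∈ S) (fun _ => Fin 2)).symm (u, v) i.val = v i := by
    intro i; simp [i.2]
  simp only [h1, h2, map_mul]
  ring

theorem sum_overlap_adaptive_le {n : ℕ} {S : Finset (Fin n)} {q : Fin n → Fin 2 → Fin 2 → ℂ}
    {g : ({i : Fin n // i ∉ S} → Fin 2) → ({i : Fin n // i ∈ S} → Fin 2) →
        ({i : Fin n // i ∈ S} → Fin 2) → ℂ} {φ : (Fin n → Fin 2) → (Fin n → Fin 2) → ℂ}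
    (hg : ∀ w, IsONB (g w))
    (hφ : ∀ x y, φ x y =
        (∏ i : {i : Fin n // i ∉ S}, q i.val (x i.val) (y i.val)) *
          g (fun i => x i.val) (fun i => x i.val) (fun i => y i.val)) (c d : Fin n → Fin 4) :
    ∑ x, ‖overlap (φ x) (prodState c)‖ * ‖overlap (φ x) (prodState d)‖ ≤
      ∏ i : {i : Fin n // i ∉ S}, fidelity (q i.val) (c i.val) (d i.val) := by
  simp only [fun x => overlap_adaptive (q := q) x (hφ x), norm_mul, norm_prod]
  rw [← Equiv.sum_comp (Equiv.piEquivPiSubtypeProd (fun i => i ∈ S) (fun _ => Fin 2)).symm,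
    Fintype.sum_prod_type, Finset.sum_comm]
  have h1 : ∀ u v, ∀ i : {i : Fin n // i ∈ S},
      (Equiv.piEquivPiSubtypeProd (fun i => i ∈ S) (fun _ => Fin 2)).symm (u, v) i.val = u i := by
    intro u v i; simp [i.2]
  have h2 : ∀ u v, ∀ i : {i : Fin n // i ∉ S},
      (Equiv.piEquivPiSubtypeProd (fun i => i ∈ S) (fun _ => Fin 2)).symm (u, v) i.val = v i := by
    intro u v i; simp [i.2]
  simp only [h1, h2]
  simp only [fidelity]
  rw [Fintype.prod_sum]
  refine Finset.sum_le_sum fun v _ => ?_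
  have h := (hg v).sum_norm_mul_norm_le
    (sum_norm_prodState_sq fun i : {i : Fin n // i ∈ S} => c i.val)
    (sum_norm_prodState_sq fun i : {i : Fin n // i ∈ S} => d i.val)
  rw [Finset.prod_mul_distrib]
  calc _ = ((∏ i : {i : Fin n // i ∉ S}, ‖overlap (q i.val (v i)) (chi (c i.val))‖) *
        ∏ i : {i : Fin n // i ∉ S}, ‖overlap (q i.val (v i)) (chi (d i.val))‖) *
        ∑ z, ‖overlap (g v z) (prodState fun i : {i : Fin n // i ∈ S} => c i.val)‖ *
          ‖overlap (g v z) (prodState fun i : {i : Fin n // i ∈ S} => d i.val)‖ := by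
        rw [Finset.mul_sum]
        refine Finset.sum_congr rfl fun u _ => ?_
        ring
    _ ≤ _ := mul_le_of_le_one_right (by positivity) h

/-- The colour forced on `u` by the last three entries of a 6-tuple of code words. -/
noncomputable def treeColor {N : ℕ} (t : Fin 3 → Fin N) (u : Fin N) : Fin 4 :=
  if u = t 2 then 3 else if u = t 1 then 2 else if u = t 0 then 1 else 0

/-- The positions at which the code words `s` and `t` carry their tree colours. -/
noncomputable def treePositions {N n : ℕ} (C : Fin N → Fin n → Fin 4) (s t : Fin 3 → Fin N) :
    Finset (Fin n) :=
  Finset.univ.filter fun i =>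
    (∀ k, C (s k) i = treeColor t (s k)) ∧ ∀ k, C (t k) i = treeColor t (t k)

theorem prod_fidelity_tree_le {N n : ℕ} {C : Fin N → Fin n → Fin 4} {S : Finset (Fin n)}
    {q : Fin n → Fin 2 → Fin 2 → ℂ} (hq : ∀ i, i ∉ S → IsONB (q i)) {s t : Fin 3 → Fin N}
    (h0 : s 0 ≠ t 0) (h1 : t 1 ≠ s 0 ∧ t 1 ≠ t 0 ∧ t 1 ≠ s 1)
    (h2 : t 2 ≠ s 0 ∧ t 2 ≠ t 0 ∧ t 2 ≠ s 1 ∧ t 2 ≠ t 1 ∧ t 2 ≠ s 2) :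
    ∏ k, ∏ i : {i : Fin n // i ∉ S}, fidelity (q i.val) (C (s k) i.val) (C (t k) i.val) ≤
      Real.exp (-(1 / 216) * (((treePositions C s t).card : ℝ) - S.card)) := by
  rw [Finset.prod_comm]
  have hb : ∀ i : {i : Fin n // i ∉ S},
      ∏ k, fidelity (q i.val) (C (s k) i.val) (C (t k) i.val) ≤
        if i.val ∈ treePositions C s t then Real.exp (-(1 / 216)) else 1 := by
    intro i
    split_ifs with hi
    · obtain ⟨hs, ht⟩ := (Finset.mem_filter.1 hi).2
      have s0 : treeColor t (s 0) = 0 := by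
        simp [treeColor, h0, h1.1.symm, h2.1.symm]
      have t0 : treeColor t (t 0) = 1 := by
        simp [treeColor, h1.2.1.symm, h2.2.1.symm]
      have s1 : treeColor t (s 1) = 0 ∨ treeColor t (s 1) = 1 := by
        simp only [treeColor, h2.2.2.1.symm, h1.2.2.symm, if_false]
        split_ifs <;> simp
      have t1 : treeColor t (t 1) = 2 := by
        simp [treeColor, h2.2.2.2.1.symm]
      have s2 : treeColor t (s 2) = 0 ∨ treeColor t (s 2) = 1 ∨ treeColor t (s 2) = 2 := by
        simp only [treeColor, h2.2.2.2.2.symm, if_false]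
        split_ifs <;> simp
      have t2 : treeColor t (t 2) = 3 := by simp [treeColor]
      rw [Fin.prod_univ_three, hs, hs, hs, ht, ht, ht, s0, t0, t1, t2]
      exact fidelity_tree_le (hq i i.2) s1 s2
    · exact Finset.prod_le_one (fun k _ => fidelity_nonneg _ _ _)
        fun k _ => fidelity_le_one (hq i i.2) _ _
  calc _ ≤ ∏ i : {i : Fin n // i ∉ S},
        if i.val ∈ treePositions C s t then Real.exp (-(1 / 216)) else 1 :=
        Finset.prod_le_prod (fun i _ => Finset.prod_nonneg fun k _ => fidelity_nonneg _ _ _)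
          fun i _ => hb i
    _ = Real.exp (-(1 / 216)) ^ ((treePositions C s t) \ S).card := by
        rw [← Finset.prod_subtype (Sᶜ) (fun i => by simp)
          (fun i => if i ∈ treePositions C s t then Real.exp (-(1 / 216)) else 1),
          ← Finset.prod_filter, Finset.prod_const]
        congr 2
        ext i; simp [and_comm]
    _ ≤ _ := by
        rw [← Real.exp_nat_mul]
        refine Real.exp_le_exp.2 ?_
        have := Finset.le_card_sdiff S (treePositions C s t)
        have h : ((treePositions C s t).card : ℝ) ≤ ((treePositions C s t) \ S).card + S.card := by
          exact_mod_cast (by omega :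
            (treePositions C s t).card ≤ ((treePositions C s t) \ S).card + S.card)
        linarith

/-- If three edges of a symmetric relation never form a forest, the relation lives on at most
three points, or consists of two disjoint edges. -/
theorem edges_dichotomy {V : Type*} [DecidableEq V] {R : V → V → Prop}
    (hsymm : ∀ u v, R u v → R v u)
    (hforest : ∀ s t : Fin 3 → V, s 0 ≠ t 0 → (t 1 ≠ s 0 ∧ t 1 ≠ t 0 ∧ t 1 ≠ s 1) →
      (t 2 ≠ s 0 ∧ t 2 ≠ t 0 ∧ t 2 ≠ s 1 ∧ t 2 ≠ t 1 ∧ t 2 ≠ s 2) → ∃ k, ¬ R (s k) (t k)) :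
    (∃ T : Finset V, T.card ≤ 3 ∧ ∀ u v, u ≠ v → R u v → u ∈ T ∧ v ∈ T) ∨
      ∃ E : Finset (V × V), E.card ≤ 4 ∧ ∀ u v, u ≠ v → R u v → (u, v) ∈ E := by
  have hf : ∀ s₀ t₀ s₁ t₁ s₂ t₂ : V, R s₀ t₀ → R s₁ t₁ → R s₂ t₂ → s₀ ≠ t₀ →
      (t₁ ≠ s₀ ∧ t₁ ≠ t₀ ∧ t₁ ≠ s₁) →
      ¬ (t₂ ≠ s₀ ∧ t₂ ≠ t₀ ∧ t₂ ≠ s₁ ∧ t₂ ≠ t₁ ∧ t₂ ≠ s₂) := by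
    intro s₀ t₀ s₁ t₁ s₂ t₂ r0 r1 r2 n0 n1 n2
    obtain ⟨k, hk⟩ := hforest ![s₀, s₁, s₂] ![t₀, t₁, t₂] n0 n1 n2
    fin_cases k
    · exact hk r0
    · exact hk r1
    · exact hk r2
  by_cases hR : ∃ s₀ t₀, s₀ ≠ t₀ ∧ R s₀ t₀
  swap
  · push Not at hR
    exact Or.inl ⟨∅, by simp, fun u v huv h => (hR u v huv h).elim⟩
  obtain ⟨a, b, hab, rab⟩ := hR
  by_cases h2 : ∃ c d, c ≠ d ∧ R c d ∧ d ≠ a ∧ d ≠ b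
  swap
  · push Not at h2
    refine Or.inl ⟨{a, b}, Finset.card_le_two.trans (by norm_num), fun u v huv h => ?_⟩
    have := h2 u v huv h
    have := h2 v u huv.symm (hsymm _ _ h)
    simp only [Finset.mem_insert, Finset.mem_singleton]
    tauto
  obtain ⟨c, d, hcd, rcd, hda, hdb⟩ := h2
  have hmem : ∀ u v, u ≠ v → R u v → (v = a ∨ v = b ∨ v = c ∨ v = d) := by
    intro u v huv h
    have := hf a b c d u v rab rcd h hab ⟨hda, hdb, hcd.symm⟩
    tauto
  by_cases hc : c = a ∨ c = b
  · refine Or.inl ⟨{a, b, d}, Finset.card_le_three, fun u v huv h => ?_⟩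
    have := hmem u v huv h
    have := hmem v u huv.symm (hsymm _ _ h)
    simp only [Finset.mem_insert, Finset.mem_singleton]
    rcases hc with rfl | rfl <;> tauto
  · push Not at hc
    refine Or.inr ⟨{(a, b), (b, a), (c, d), (d, c)}, Finset.card_le_four, fun u v huv h => ?_⟩
    have h1 := hmem u v huv h
    have h2 := hmem v u huv.symm (hsymm _ _ h)
    have rba := hsymm _ _ rab
    have rdc := hsymm _ _ rcd
    have cross : ∀ u v, (u = a ∨ u = b) → (v = c ∨ v = d) → ¬ R u v := by
      rintro u v (rfl | rfl) (rfl | rfl) h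
      · exact hf _ _ _ _ _ _ rab h rcd hab ⟨hc.1, hc.2, hc.1⟩ ⟨hda, hdb, hda, hcd.symm, hcd.symm⟩
      · exact hf _ _ _ _ _ _ rab h rdc hab ⟨hda, hdb, hda⟩ ⟨hc.1, hc.2, hc.1, hcd, hcd⟩
      · exact hf _ _ _ _ _ _ rab h rcd hab ⟨hc.1, hc.2, hc.2⟩ ⟨hda, hdb, hdb, hcd.symm, hcd.symm⟩
      · exact hf _ _ _ _ _ _ rab h rdc hab ⟨hda, hdb, hdb⟩ ⟨hc.1, hc.2, hc.2, hcd, hcd⟩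
    have c1 := cross u v
    have c2 := cross v u
    have h' := hsymm _ _ h
    simp only [Finset.mem_insert, Finset.mem_singleton, Prod.mk.injEq]
    grind

/-- Almost orthonormal families of at most three vectors have cross-term mass about four. -/
theorem sum_norm_cross_triple_le {X V : Type*} [Fintype X] [DecidableEq V] {a : X → V → ℂ}
    (h1 : ∀ s, ∑ x, ‖a x s‖ ^ 2 = 1)
    (h2 : ∀ s t, s ≠ t → ‖∑ x, conj (a x s) * a x t‖ ≤ 1 / 9) {T : Finset V} (hT : T.card ≤ 3) :
    ∑ x, ‖∑ p ∈ (T ×ˢ T).filter (fun p => p.1 ≠ p.2), a x p.1 * conj (a x p.2)‖ ≤ 9 / 2 := by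
  have hT' : (T.card : ℝ) ≤ 3 := by exact_mod_cast hT
  have hpt : ∀ x, ‖∑ p ∈ (T ×ˢ T).filter (fun p => p.1 ≠ p.2), a x p.1 * conj (a x p.2)‖ ≤
      ‖∑ s ∈ T, a x s‖ ^ 2 / 3 + ∑ s ∈ T, ‖a x s‖ ^ 2 := by
    intro x
    have hcs : ‖∑ s ∈ T, a x s‖ ^ 2 ≤ 3 * ∑ s ∈ T, ‖a x s‖ ^ 2 := by
      calc ‖∑ s ∈ T, a x s‖ ^ 2 ≤ (∑ s ∈ T, ‖a x s‖) ^ 2 := by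
            gcongr; exact norm_sum_le _ _
        _ ≤ T.card * ∑ s ∈ T, ‖a x s‖ ^ 2 := sq_sum_le_card_mul_sum_sq
        _ ≤ _ := by gcongr
    have hsq : ∑ p ∈ (T ×ˢ T).filter (fun p => p.1 ≠ p.2), a x p.1 * conj (a x p.2) =
        ((‖∑ s ∈ T, a x s‖ ^ 2 - ∑ s ∈ T, ‖a x s‖ ^ 2 : ℝ) : ℂ) := by
      have hall : ∑ p ∈ T ×ˢ T, a x p.1 * conj (a x p.2) = ((‖∑ s ∈ T, a x s‖ ^ 2 : ℝ) : ℂ) := by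
        rw [Complex.ofReal_pow, ← Complex.mul_conj', map_sum, Finset.sum_mul_sum,
          Finset.sum_product]
      have hdiag : ∑ p ∈ (T ×ˢ T).filter (fun p => ¬ p.1 ≠ p.2), a x p.1 * conj (a x p.2) =
          ((∑ s ∈ T, ‖a x s‖ ^ 2 : ℝ) : ℂ) := by
        rw [Finset.sum_filter, Finset.sum_product]
        push_cast
        refine Finset.sum_congr rfl fun s hs => ?_
        simp [hs, Complex.mul_conj']
      rw [Complex.ofReal_sub, ← hall, ← hdiag]
      exact eq_sub_of_add_eq (Finset.sum_filter_add_sum_filter_not _ _ _)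
    rw [hsq, Complex.norm_real, Real.norm_eq_abs, abs_le]
    have : 0 ≤ ‖∑ s ∈ T, a x s‖ ^ 2 := by positivity
    constructor <;> linarith
  have hS : ∑ x, ‖∑ s ∈ T, a x s‖ ^ 2 ≤ 4 := by
    have e : ((∑ x, ‖∑ s ∈ T, a x s‖ ^ 2 : ℝ) : ℂ) =
        ∑ s ∈ T, ∑ t ∈ T, ∑ x, conj (a x s) * a x t := by
      push_cast
      simp only [← Complex.conj_mul', map_sum, Finset.sum_mul_sum]
      rw [Finset.sum_comm]
      refine Finset.sum_congr rfl fun s _ => ?_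
      rw [Finset.sum_comm]
    have hst : ∀ s t, ‖∑ x, conj (a x s) * a x t‖ ≤ (if s = t then 1 else 0) + 1 / 9 := by
      intro s t
      split_ifs with h
      · subst h
        simp only [Complex.conj_mul']
        have := h1 s
        rw [show ∑ x, (‖a x s‖ : ℂ) ^ 2 = ((∑ x, ‖a x s‖ ^ 2 : ℝ) : ℂ) by push_cast; rfl, this]
        norm_num
      · linarith [h2 s t h]
    have h0 : 0 ≤ ∑ x, ‖∑ s ∈ T, a x s‖ ^ 2 := by positivity
    calc ∑ x, ‖∑ s ∈ T, a x s‖ ^ 2 = ‖((∑ x, ‖∑ s ∈ T, a x s‖ ^ 2 : ℝ) : ℂ)‖ := by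
          rw [Complex.norm_real, Real.norm_of_nonneg h0]
      _ ≤ ∑ s ∈ T, ∑ t ∈ T, ((if s = t then 1 else 0) + 1 / 9 : ℝ) := by
          rw [e]
          exact (norm_sum_le _ _).trans (Finset.sum_le_sum fun s _ =>
            (norm_sum_le _ _).trans (Finset.sum_le_sum fun t _ => hst s t))
      _ = T.card + T.card * (T.card * (1 / 9)) := by
          simp [Finset.sum_add_distrib]
      _ ≤ 4 := by nlinarith [(Nat.cast_nonneg T.card : (0 : ℝ) ≤ T.card)]
  have hQ : ∑ x, ∑ s ∈ T, ‖a x s‖ ^ 2 ≤ 3 := by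
    rw [Finset.sum_comm]
    simpa [h1] using hT'
  calc _ ≤ ∑ x, (‖∑ s ∈ T, a x s‖ ^ 2 / 3 + ∑ s ∈ T, ‖a x s‖ ^ 2) :=
        Finset.sum_le_sum fun x _ => hpt x
    _ ≤ 9 / 2 := by
        rw [Finset.sum_add_distrib, ← Finset.sum_div]
        linarith

theorem sum_norm_sum_pairs_le {X V : Type*} [Fintype X] (a : X → V → ℂ) (P : Finset (V × V))
    {κ : ℝ} (h : ∀ p ∈ P, ∑ x, ‖a x p.1‖ * ‖a x p.2‖ ≤ κ) :
    ∑ x, ‖∑ p ∈ P, a x p.1 * conj (a x p.2)‖ ≤ P.card * κ := by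
  calc _ ≤ ∑ x, ∑ p ∈ P, ‖a x p.1‖ * ‖a x p.2‖ := Finset.sum_le_sum fun x _ =>
        (norm_sum_le _ _).trans_eq (by simp)
    _ = ∑ p ∈ P, ∑ x, ‖a x p.1‖ * ‖a x p.2‖ := Finset.sum_comm
    _ ≤ _ := by simpa using Finset.sum_le_sum h

theorem sum_norm_cross_le {X V : Type*} [Fintype X] [Fintype V] [DecidableEq V] {a : X → V → ℂ}
    {τ : ℝ} (hτ : 0 ≤ τ) (hτV : (Fintype.card V : ℝ) ^ 2 * τ ≤ 1 / 2)
    (h1 : ∀ s, ∑ x, ‖a x s‖ ^ 2 = 1)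
    (h2 : ∀ s t, s ≠ t → ‖∑ x, conj (a x s) * a x t‖ ≤ 1 / 9)
    (hforest : ∀ s t : Fin 3 → V, s 0 ≠ t 0 → (t 1 ≠ s 0 ∧ t 1 ≠ t 0 ∧ t 1 ≠ s 1) →
      (t 2 ≠ s 0 ∧ t 2 ≠ t 0 ∧ t 2 ≠ s 1 ∧ t 2 ≠ t 1 ∧ t 2 ≠ s 2) →
      ∃ k, ¬ τ < ∑ x, ‖a x (s k)‖ * ‖a x (t k)‖) :
    ∑ x, ‖∑ s, ∑ t, if s ≠ t then a x s * conj (a x t) else 0‖ ≤ 5 := by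
  have hM : ∀ s t, ∑ x, ‖a x s‖ * ‖a x t‖ ≤ 1 := by
    intro s t
    have := Finset.sum_mul_sq_le_sq_mul_sq Finset.univ (fun x => ‖a x s‖) (fun x => ‖a x t‖)
    rw [h1, h1] at this
    exact (sq_le_one_iff₀ (by positivity)).1 (by linarith)
  have hsplit : ∀ P : Finset (V × V),
      (∀ s t, s ≠ t → τ < ∑ x, ‖a x s‖ * ‖a x t‖ → (s, t) ∈ P) →
      ∑ x, ‖∑ s, ∑ t, if s ≠ t then a x s * conj (a x t) else 0‖ ≤
        ∑ x, ‖∑ p ∈ P.filter (fun p => p.1 ≠ p.2), a x p.1 * conj (a x p.2)‖ + 1 / 2 := by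
    intro P hP
    have hrest := sum_norm_sum_pairs_le a (Pᶜ.filter fun p => p.1 ≠ p.2) (κ := τ) (by
      rintro ⟨s, t⟩ hp
      simp only [Finset.mem_filter, Finset.mem_compl] at hp
      exact not_lt.1 fun h => hp.1 (hP s t hp.2 h))
    have hcard : (((Pᶜ.filter fun p => p.1 ≠ p.2).card : ℕ) : ℝ) ≤ (Fintype.card V : ℝ) ^ 2 := by
      have := Finset.card_le_univ (Pᶜ.filter fun p => p.1 ≠ p.2)
      rw [Fintype.card_prod, ← sq] at this
      exact_mod_cast this
    have heq : ∀ x, (∑ s, ∑ t, if s ≠ t then a x s * conj (a x t) else 0) =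
        ∑ p ∈ P.filter (fun p => p.1 ≠ p.2), a x p.1 * conj (a x p.2) +
          ∑ p ∈ Pᶜ.filter (fun p => p.1 ≠ p.2), a x p.1 * conj (a x p.2) := by
      intro x
      rw [Finset.sum_filter, Finset.sum_filter, Finset.sum_add_sum_compl,
        Fintype.sum_prod_type]
    calc _ ≤ ∑ x, (‖∑ p ∈ P.filter (fun p => p.1 ≠ p.2), a x p.1 * conj (a x p.2)‖ +
          ‖∑ p ∈ Pᶜ.filter (fun p => p.1 ≠ p.2), a x p.1 * conj (a x p.2)‖) :=
          Finset.sum_le_sum fun x _ => by rw [heq]; exact norm_add_le _ _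
      _ ≤ _ := by
          rw [Finset.sum_add_distrib]
          have := mul_le_mul_of_nonneg_right hcard hτ
          linarith
  rcases edges_dichotomy (R := fun s t => τ < ∑ x, ‖a x s‖ * ‖a x t‖)
    (fun u v h => by simpa only [mul_comm] using h) hforest with ⟨T, hT, hTR⟩ | ⟨E, hE, hER⟩
  · have h := hsplit (T ×ˢ T) fun s t hst h => Finset.mem_product.2 (hTR s t hst h)
    have := sum_norm_cross_triple_le h1 h2 hT
    linarith
  · have h := hsplit E hER
    have h4 := sum_norm_sum_pairs_le a (E.filter fun p => p.1 ≠ p.2) (κ := 1)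
      fun p _ => hM p.1 p.2
    have h5 : (((E.filter fun p => p.1 ≠ p.2).card : ℕ) : ℝ) ≤ 4 := by
      exact_mod_cast (Finset.card_filter_le _ _).trans hE
    linarith

theorem norm_overlap_prodState_le {N n : ℕ} {C : Fin N → Fin n → Fin 4} {s t : Fin N}
    (hst : s ≠ t) (h4 : 4 ≤ (treePositions C (fun _ => s) fun _ => t).card) :
    ‖overlap (prodState (C s)) (prodState (C t))‖ ≤ 1 / 9 := by
  have h : ‖overlap (prodState (C s)) (prodState (C t))‖ ^ 2 ≤ (1 / 9) ^ 2 := by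
    rw [overlap_prodState, norm_prod, ← Finset.prod_pow]
    calc _ ≤ ∏ i, if i ∈ treePositions C (fun _ => s) (fun _ => t) then (1 / 3 : ℝ) else 1 := by
          refine Finset.prod_le_prod (fun i _ => by positivity) fun i _ => ?_
          split_ifs with hi
          · obtain ⟨h1, h2⟩ := (Finset.mem_filter.1 hi).2
            rw [h1 0, h2 0]
            simp [treeColor, hst, norm_overlap_chi_zero_three_sq]
          · exact pow_le_one₀ (norm_nonneg _)
              (norm_overlap_le_one (sum_norm_chi_sq _) (sum_norm_chi_sq _))
      _ = (1 / 3) ^ (treePositions C (fun _ => s) fun _ => t).card := by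
          rw [← Finset.prod_filter, Finset.prod_const, Finset.filter_univ_mem]
      _ ≤ (1 / 3) ^ 4 := pow_le_pow_of_le_one (by norm_num) (by norm_num) h4
      _ = _ := by norm_num
  exact (sq_le_sq₀ (norm_nonneg _) (by norm_num)).1 h

theorem IsAdaptiveBasis.sum_norm_cross_le {N n ℓ : ℕ} {φ : (Fin n → Fin 2) → (Fin n → Fin 2) → ℂ}
    (hφ : IsAdaptiveBasis n ℓ φ) {C : Fin N → Fin n → Fin 4} {m τ : ℝ} (hm : 4 ≤ m)
    (hC : ∀ s t, m ≤ (treePositions C s t).card) (hτ : 0 ≤ τ) (hτN : (N : ℝ) ^ 2 * τ ≤ 1 / 2)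
    (hτm : Real.exp (-(1 / 216) * (m - ℓ)) ≤ τ ^ 3) :
    ∑ x, ‖∑ s, ∑ t, if s ≠ t then
      overlap (φ x) (sicProd n (C s)) * conj (overlap (φ x) (sicProd n (C t))) else 0‖ ≤ 5 := by
  obtain ⟨hφ, S, hS, q, g, hq, hg, hφg⟩ := hφ
  have hφ' : IsONB φ := hφ
  refine _root_.sum_norm_cross_le (a := fun x s => overlap (φ x) (sicProd n (C s))) hτ
    (by simpa using hτN) (fun s => ?_) (fun s t hst => ?_) fun s t h0 h1 h2 => ?_
  · rw [hφ'.sum_norm_sq]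
    exact sum_norm_prodState_sq _
  · rw [hφ'.parseval]
    exact norm_overlap_prodState_le hst (by exact_mod_cast hm.trans (hC _ _))
  · by_contra! hlt
    have hle : ∀ k, τ < ∏ i : {i : Fin n // i ∉ S},
        fidelity (q i.val) (C (s k) i.val) (C (t k) i.val) := fun k =>
      (hlt k).trans_le (sum_overlap_adaptive_le hg hφg _ _)
    have h3 : τ ^ 3 < ∏ k, ∏ i : {i : Fin n // i ∉ S},
        fidelity (q i.val) (C (s k) i.val) (C (t k) i.val) := by
      rw [Fin.prod_univ_three]
      calc τ ^ 3 = τ * τ * τ := by ring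
        _ < _ := mul_lt_mul'' (mul_lt_mul'' (hle 0) (hle 1) hτ hτ) (hle 2) (by positivity) hτ
    have h4 := prod_fidelity_tree_le (C := C) hq h0 h1 h2
    have h5 : Real.exp (-(1 / 216) * (((treePositions C s t).card : ℝ) - S.card)) ≤
        Real.exp (-(1 / 216) * (m - ℓ)) := by
      refine Real.exp_le_exp.2 ?_
      have := hC s t
      have : (S.card : ℝ) ≤ ℓ := by exact_mod_cast hS
      linarith
    linarith

theorem card_fun_le_mul_card_treeColor {N : ℕ} (s t : Fin 3 → Fin N) :
    4 ^ N ≤ 4096 * (Finset.univ.filter fun c : Fin N → Fin 4 =>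
      (∀ k, c (s k) = treeColor t (s k)) ∧ ∀ k, c (t k) = treeColor t (t k)).card := by
  set K := Finset.univ.filter fun c : Fin N → Fin 4 =>
      (∀ k, c (s k) = treeColor t (s k)) ∧ ∀ k, c (t k) = treeColor t (t k) with hK
  let V : Set (Fin N) := Set.range s ∪ Set.range t
  have hle : (Finset.univ : Finset (Fin N → Fin 4)).card ≤
      ((Finset.univ : Finset ((Fin 3 → Fin 4) × (Fin 3 → Fin 4))) ×ˢ K).card := by
    refine Finset.card_le_card_of_injOn
      (fun c => ((c ∘ s, c ∘ t), V.piecewise (treeColor t) c)) (fun c _ => ?_) ?_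
    · simp [hK, V, Set.piecewise]
    · intro c _ d _ h
      simp only [Prod.mk.injEq] at h
      obtain ⟨⟨h1, h2⟩, h3⟩ := h
      funext v
      by_cases hv : v ∈ V
      · rcases hv with ⟨k, rfl⟩ | ⟨k, rfl⟩
        · exact congrFun h1 k
        · exact congrFun h2 k
      · simpa [Set.piecewise, hv] using congrFun h3 v
  simpa [Finset.card_product] using hle

theorem sum_exp_neg_card_treePositions_le {N : ℕ} (n : ℕ) (s t : Fin 3 → Fin N) :
    ∑ C : Fin N → Fin n → Fin 4, Real.exp (-((treePositions C s t).card : ℝ)) ≤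
      (Fintype.card (Fin N → Fin n → Fin 4) : ℝ) * Real.exp (-(n / 8192)) := by
  let θ : (Fin N → Fin 4) → ℝ := fun c =>
    if (∀ k, c (s k) = treeColor t (s k)) ∧ ∀ k, c (t k) = treeColor t (t k)
    then Real.exp (-1) else 1
  have hprod : ∀ C : Fin N → Fin n → Fin 4,
      Real.exp (-((treePositions C s t).card : ℝ)) = ∏ i, θ fun u => C u i := by
    intro C
    rw [← Finset.prod_filter, Finset.prod_const, ← Real.exp_nat_mul, mul_neg_one]
    rfl
  have he : Real.exp (-1) ≤ 1 / 2 := by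
    have := Real.exp_one_gt_d9
    rw [Real.exp_neg, inv_le_comm₀ (Real.exp_pos _) (by norm_num)]
    linarith
  have hsum : ∑ c, θ c ≤ (4 : ℝ) ^ N * Real.exp (-(1 / 8192)) := by
    have hc := card_fun_le_mul_card_treeColor s t
    set K := Finset.univ.filter fun c : Fin N → Fin 4 =>
      (∀ k, c (s k) = treeColor t (s k)) ∧ ∀ k, c (t k) = treeColor t (t k) with hK
    have hc' : (4 : ℝ) ^ N ≤ 4096 * K.card := by exact_mod_cast hc
    have h1 : ∑ c, θ c ≤ ∑ c : Fin N → Fin 4, (1 - (if c ∈ K then 1 / 2 else 0 : ℝ)) := by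
      refine Finset.sum_le_sum fun c _ => ?_
      simp only [θ, hK, Finset.mem_filter, Finset.mem_univ, true_and]
      split_ifs
      · linarith
      · norm_num
    have h2 : ∑ c : Fin N → Fin 4, (1 - (if c ∈ K then 1 / 2 else 0 : ℝ)) =
        4 ^ N - K.card * (1 / 2) := by
      simp [Finset.sum_sub_distrib]
    have h3 := Real.add_one_le_exp (-(1 / 8192 : ℝ))
    have h4 : (4 : ℝ) ^ N * (-(1 / 8192) + 1) ≤ 4 ^ N * Real.exp (-(1 / 8192)) := by gcongr
    linarith
  calc _ = ∑ C : Fin N → Fin n → Fin 4, ∏ i, θ fun u => C u i :=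
        Finset.sum_congr rfl fun C _ => hprod C
    _ = ∑ D : Fin n → Fin N → Fin 4, ∏ i, θ (D i) :=
        (Equiv.piComm fun (_ : Fin N) (_ : Fin n) => Fin 4).sum_comp fun D => ∏ i, θ (D i)
    _ = (∑ c, θ c) ^ n := by rw [← Fintype.prod_sum]; simp
    _ ≤ ((4 : ℝ) ^ N * Real.exp (-(1 / 8192))) ^ n := by
        refine pow_le_pow_left₀ (Finset.sum_nonneg fun c _ => ?_) hsum n
        simp only [θ]; positivity
    _ = _ := by
        rw [mul_pow, ← Real.exp_nat_mul]
        simp only [Fintype.card_pi, Fintype.card_fin, Finset.prod_const, Finset.card_univ]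
        push_cast
        rw [← pow_mul, ← pow_mul, mul_comm N n]
        congr 2
        ring

theorem card_filter_treePositions_lt_le {N : ℕ} (n : ℕ) (m : ℝ) :
    ((Finset.univ.filter fun C : Fin N → Fin n → Fin 4 =>
      ∃ s t, ((treePositions C s t).card : ℝ) < m).card : ℝ) ≤
      (N : ℝ) ^ 6 * (Fintype.card (Fin N → Fin n → Fin 4) * Real.exp (m - n / 8192)) := by
  have hone : ∀ s t : Fin 3 → Fin N, ((Finset.univ.filter fun C : Fin N → Fin n → Fin 4 =>
      ((treePositions C s t).card : ℝ) < m).card : ℝ) ≤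
      Fintype.card (Fin N → Fin n → Fin 4) * Real.exp (m - n / 8192) := by
    intro s t
    have h1 : ((Finset.univ.filter fun C : Fin N → Fin n → Fin 4 =>
        ((treePositions C s t).card : ℝ) < m).card : ℝ) ≤
        ∑ C : Fin N → Fin n → Fin 4, Real.exp (m - (treePositions C s t).card) := by
      rw [Finset.card_filter]
      push_cast
      refine Finset.sum_le_sum fun C _ => ?_
      split_ifs with h
      · exact Real.one_le_exp (by linarith)
      · positivity
    have h2 := mul_le_mul_of_nonneg_left (sum_exp_neg_card_treePositions_le n s t)
      (Real.exp_pos m).le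
    simp only [sub_eq_add_neg, Real.exp_add, ← Finset.mul_sum] at h1 ⊢
    linarith
  calc _ ≤ ((∑ p : (Fin 3 → Fin N) × (Fin 3 → Fin N),
        (Finset.univ.filter fun C : Fin N → Fin n → Fin 4 =>
          ((treePositions C p.1 p.2).card : ℝ) < m).card : ℕ) : ℝ) := by
        refine Nat.cast_le.2 (le_trans (Finset.card_le_card ?_) Finset.card_biUnion_le)
        intro C hC
        obtain ⟨s, t, h⟩ := (Finset.mem_filter.1 hC).2
        simp only [Finset.mem_biUnion, Finset.mem_filter, Finset.mem_univ, true_and]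
        exact ⟨(s, t), h⟩
    _ ≤ ∑ p : (Fin 3 → Fin N) × (Fin 3 → Fin N),
        (Fintype.card (Fin N → Fin n → Fin 4) * Real.exp (m - n / 8192)) := by
        push_cast
        exact Finset.sum_le_sum fun p _ => hone p.1 p.2
    _ = _ := by
        simp only [Finset.sum_const, Finset.card_univ, Fintype.card_prod, Fintype.card_pi,
          Fintype.card_fin, Finset.prod_const, nsmul_eq_mul]
        push_cast
        ring

theorem NN_le_exp (n : ℕ) : (NN n : ℝ) ≤ Real.exp (n / 10 ^ 10) := by
  refine (Nat.floor_le (by positivity)).trans ?_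
  rw [Real.rpow_def_of_pos two_pos]
  refine Real.exp_le_exp.2 ?_
  have h : (10 : ℝ) ^ (-10 : ℝ) = 1 / 10 ^ 10 := by
    rw [Real.rpow_neg (by norm_num)]; norm_num
  rw [h]
  have h2 : Real.log 2 ≤ 1 := by linarith [Real.log_two_lt_d9]
  have : (0 : ℝ) ≤ 1 / 10 ^ 10 * n := by positivity
  nlinarith

theorem floor_adaptivity_le (n : ℕ) :
    ((Nat.floor ((10 : ℝ) ^ (-8 : ℝ) * n) : ℕ) : ℝ) ≤ n / 10 ^ 8 := by
  have h : (10 : ℝ) ^ (-8 : ℝ) = 1 / 10 ^ 8 := by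
    rw [Real.rpow_neg (by norm_num)]; norm_num
  refine (Nat.floor_le (by positivity)).trans ?_
  rw [h]
  linarith

/-- for all large n, at least a 0.9 fraction of tuples
C ∈ ({0,1,2,3}^n)^N are such that for every ⌊10⁻⁸·n⌋-adaptive orthonormal basis (φ_x),
the total cross-term mass Σ_x |Σ_{s≠t} ⟨φ_x,ψ_{c^s}⟩·conj(⟨φ_x,ψ_{c^t}⟩)| is at most 5. -/
theorem stmt_15 :
    ∃ n₀ : ℕ, ∀ n : ℕ, n₀ ≤ n →
      (0.9 : ℝ) * (Fintype.card (Fin (NN n) → Fin n → Fin 4) : ℝ) ≤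
        ((Finset.univ.filter fun C : Fin (NN n) → Fin n → Fin 4 =>
          ∀ φ : (Fin n → Fin 2) → (Fin n → Fin 2) → ℂ,
            IsAdaptiveBasis n (Nat.floor ((10 : ℝ) ^ (-8 : ℝ) * n)) φ →
            ∑ x, ‖∑ s, ∑ t, if s ≠ t then
                  (∑ y, conj (φ x y) * sicProd n (C s) y)
                    * conj (∑ y, conj (φ x y) * sicProd n (C t) y)
                else 0‖ ≤ 5).card : ℝ) := by
  refine ⟨10 ^ 9, fun n hn => ?_⟩
  have hn' : (10 : ℝ) ^ 9 ≤ n := by exact_mod_cast hn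
  have hN := NN_le_exp n
  have hsmall : ∀ y : ℝ, 9 ≤ y → Real.exp (-y) ≤ 1 / 10 := by
    intro y hy
    rw [Real.exp_neg, inv_le_comm₀ (Real.exp_pos _) (by norm_num)]
    linarith [Real.add_one_le_exp y]
  set T : ℝ := ((Fintype.card (Fin (NN n) → Fin n → Fin 4) : ℕ) : ℝ) with hT
  have hbad : ((Finset.univ.filter fun C : Fin (NN n) → Fin n → Fin 4 =>
      ∃ s t, ((treePositions C s t).card : ℝ) < n / 20000).card : ℝ) ≤ T * (1 / 10) := by
    refine (card_filter_treePositions_lt_le n _).trans ?_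
    calc _ ≤ Real.exp (n / 10 ^ 10) ^ 6 * (T * Real.exp (n / 20000 - n / 8192)) := by gcongr
      _ = T * Real.exp (-(n * (1 / 8192 - 1 / 20000 - 6 / 10 ^ 10))) := by
        rw [← Real.exp_nat_mul, mul_left_comm, ← Real.exp_add]
        congr 2
        push_cast
        ring
      _ ≤ T * (1 / 10) := by
        gcongr
        exact hsmall _ (by linarith)
  have hsplit := Finset.card_filter_add_card_filter_not (s := Finset.univ)
    (fun C : Fin (NN n) → Fin n → Fin 4 => ∃ s t, ((treePositions C s t).card : ℝ) < n / 20000)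
  have hsplit' : ((Finset.univ.filter fun C : Fin (NN n) → Fin n → Fin 4 =>
      ∃ s t, ((treePositions C s t).card : ℝ) < n / 20000).card : ℝ) +
      (Finset.univ.filter fun C : Fin (NN n) → Fin n → Fin 4 =>
      ¬ ∃ s t, ((treePositions C s t).card : ℝ) < n / 20000).card = T := by
    rw [hT]
    exact_mod_cast hsplit
  have hgood : (0.9 : ℝ) * T ≤ (Finset.univ.filter fun C : Fin (NN n) → Fin n → Fin 4 =>
      ¬ ∃ s t, ((treePositions C s t).card : ℝ) < n / 20000).card := by
    linarith
  refine hgood.trans (Nat.cast_le.2 (Finset.card_le_card ?_))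
  refine Finset.monotone_filter_right _ fun C _ hC φ hφ => ?_
  push Not at hC
  have hℓ := floor_adaptivity_le n
  refine hφ.sum_norm_cross_le (m := n / 20000) (τ := Real.exp (-(n / 10 ^ 8))) (by linarith) hC
    (Real.exp_pos _).le ?_ ?_
  · calc _ ≤ Real.exp (n / 10 ^ 10) ^ 2 * Real.exp (-(n / 10 ^ 8)) := by gcongr
      _ = Real.exp (-(n * (1 / 10 ^ 8 - 2 / 10 ^ 10))) := by
        rw [← Real.exp_nat_mul, ← Real.exp_add]
        congr 1
        push_cast
        ring
      _ ≤ 1 / 10 := hsmall _ (by linarith)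
      _ ≤ 1 / 2 := by norm_num
  · rw [← Real.exp_nat_mul]
    refine Real.exp_le_exp.2 ?_
    push_cast
    linarith
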